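/- arXiv:1906.06417 — 3 statements merged into one kernel-verified Lean document; each statement's English description precedes it below -/
import Mathlib

section
/- If the column span of a matrix V ∈ ℂ^{n×p} has dimension t, then there exists a matrix V' ∈ ℂ^{n×t} whose columns are pairwise orthogonal nonzero vectors spanning the same subspace as the columns of V, and such that the diagonal of V' V'^* equals the diagonal of V V*. -/
open Matrix

open scoped ComplexOrder in
/-- A complex matrix and its Gram matrix `M * Mᴴ` have the same column span. -/
theorem span_range_col_self_mul_conjTranspose {m k : ℕ} (M : Matrix (Fin m) (Fin k) ℂ) :
    Submodule.span ℂ (Set.range (M * Mᴴ).col) = Submodule.span ℂ (Set.range M.col) := by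
  rw [← range_mulVecLin, ← range_mulVecLin]
  refine Submodule.eq_of_le_of_finrank_eq ?_ (rank_self_mul_conjTranspose M)
  rw [mulVecLin_mul]
  exact LinearMap.range_comp_le_range _ _

open scoped ComplexOrder in
/-- Every Gram matrix `M * Mᴴ` has a factor with `M.rank` pairwise orthogonal nonzero columns. -/
theorem exists_orthogonal_columns_self_mul_conjTranspose_eq {n p t : ℕ}
    (V : Matrix (Fin n) (Fin p) ℂ) (ht : t = V.rank) :
    ∃ V' : Matrix (Fin n) (Fin t) ℂ, (∀ j, V'.col j ≠ 0) ∧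
      (∀ j k, j ≠ k → ∑ i, star (V' i j) * V' i k = 0) ∧ V' * V'ᴴ = V * Vᴴ := by
  have hA : (V * Vᴴ).IsHermitian := isHermitian_mul_conjTranspose_self V
  have hpos : ∀ i, 0 ≤ hA.eigenvalues i := (posSemidef_self_mul_conjTranspose V).eigenvalues_nonneg
  have hcard : Fintype.card {i // hA.eigenvalues i ≠ 0} = t := by
    rw [← hA.rank_eq_card_non_zero_eigs, rank_self_mul_conjTranspose, ht]
  obtain e : Fin t ≃ {i // hA.eigenvalues i ≠ 0} := (Fintype.equivFinOfCardEq hcard).symm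
  let U : Matrix (Fin n) (Fin n) ℂ := hA.eigenvectorUnitary
  have hUU : Uᴴ * U = 1 := Unitary.coe_star_mul_self hA.eigenvectorUnitary
  have hinner : ∀ j k, ∑ i, star (U i j) * U i k = if j = k then 1 else 0 := fun j k => by
    simpa [mul_apply, one_apply] using congrFun (congrFun hUU j) k
  refine ⟨of fun i j => (Real.sqrt (hA.eigenvalues (e j)) : ℂ) * U i (e j), ?_, ?_, ?_⟩
  · intro j hj
    have hs : (Real.sqrt (hA.eigenvalues (e j)) : ℂ) ≠ 0 := by
      exact_mod_cast (Real.sqrt_pos.2 ((hpos _).lt_of_ne' (e j).2)).ne'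
    have h0 : ∀ i, U i (e j) = 0 := fun i => by
      simpa [hs] using congrFun hj i
    simpa [h0] using hinner (e j) (e j)
  · intro j k hjk
    have h := hinner (e j) (e k)
    rw [if_neg fun h => hjk (e.injective (Subtype.ext h))] at h
    calc _ = (Real.sqrt (hA.eigenvalues (e j)) : ℂ) * Real.sqrt (hA.eigenvalues (e k)) *
          ∑ i, star (U i (e j)) * U i (e k) := by
          rw [Finset.mul_sum]
          refine Finset.sum_congr rfl fun i _ => ?_
          simp
          ring
      _ = 0 := by rw [h, mul_zero]
  · have hspec : V * Vᴴ = U * diagonal (fun i => (hA.eigenvalues i : ℂ)) * Uᴴ := by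
      conv_lhs => rw [hA.spectral_theorem]
      rfl
    ext a b
    have hb : (V * Vᴴ) a b = ∑ i, (hA.eigenvalues i : ℂ) * (U a i * star (U b i)) := by
      refine (congrFun (congrFun hspec a) b).trans ?_
      rw [mul_apply]
      refine Finset.sum_congr rfl fun i _ => ?_
      rw [mul_diagonal, conjTranspose_apply]
      ring
    have hsub : ∑ i, (hA.eigenvalues i : ℂ) * (U a i * star (U b i)) =
        ∑ i : {i // hA.eigenvalues i ≠ 0},
          (hA.eigenvalues i : ℂ) * (U a i * star (U b i)) := by
      rw [← Fintype.sum_subtype_add_sum_subtype (fun i => hA.eigenvalues i ≠ 0), add_eq_left]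
      refine Finset.sum_eq_zero fun i _ => ?_
      rw [not_not.1 i.2, Complex.ofReal_zero, zero_mul]
    rw [hb, hsub, ← e.sum_comp, mul_apply]
    refine Finset.sum_congr rfl fun j _ => ?_
    have hs : (Real.sqrt (hA.eigenvalues (e j)) : ℂ) * Real.sqrt (hA.eigenvalues (e j)) =
        hA.eigenvalues (e j) := by
      exact_mod_cast Real.mul_self_sqrt (hpos _)
    rw [← hs]
    simp
    ring

/-- If the column span of `V ∈ ℂ^{n×p}` has dimension `t`, there is a matrix
`V' ∈ ℂ^{n×t}` with pairwise orthogonal nonzero columns spanning the same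
subspace, and with `diag (V' V'ᴴ) = diag (V Vᴴ)`. -/
theorem exists_orthogonal_columns_same_diag (n p t : ℕ)
    (V : Matrix (Fin n) (Fin p) ℂ)
    (ht : t = Module.finrank ℂ
      (Submodule.span ℂ (Set.range fun j : Fin p => fun i : Fin n => V i j))) :
    ∃ V' : Matrix (Fin n) (Fin t) ℂ,
      (∀ j : Fin t, (fun i : Fin n => V' i j) ≠ 0) ∧
      (∀ j k : Fin t, j ≠ k → ∑ i : Fin n, star (V' i j) * V' i k = 0) ∧
      Submodule.span ℂ (Set.range fun j : Fin t => fun i : Fin n => V' i j)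
        = Submodule.span ℂ (Set.range fun j : Fin p => fun i : Fin n => V i j) ∧
      (V' * V'ᴴ).diag = (V * Vᴴ).diag := by
  obtain ⟨V', hne, horth, hVV⟩ := exists_orthogonal_columns_self_mul_conjTranspose_eq V
    (ht.trans V.rank_eq_finrank_span_cols.symm)
  refine ⟨V', hne, horth, ?_, congrArg diag hVV⟩
  have h := span_range_col_self_mul_conjTranspose V'
  rw [hVV, span_range_col_self_mul_conjTranspose] at h
  exact h.symm
end

section
/- Let V and W be orthogonal subspaces of ℂ^n. If there exist nonzero vectors v^1,...,v^p ∈ V and w^1,...,w^q ∈ W with ∑_{i=1}^p v^i ∘ conj(v^i) = ∑_{j=1}^q w^j ∘ conj(w^j), then there exist pairwise orthogonal nonzero vectors ṽ^1,...,ṽ^t ∈ V and pairwise orthogonal nonzero vectors w̃^1,...,w̃^h ∈ W with ∑_{i=1}^t ṽ^i ∘ conj(ṽ^i) = ∑_{j=1}^h w̃^j ∘ conj(w̃^j). -/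
open scoped InnerProductSpace

open Matrix in
/-- A finite family in a subspace `V` of `ℂ^n` can be mixed by a unitary matrix diagonalizing its
Gram matrix into a pairwise orthogonal family in `V` with the same Hadamard sum. -/
theorem exists_pairwise_orthogonal_hadamard_sum_eq {ι m : Type*} [Fintype ι] [Fintype m]
    (V : Submodule ℂ (EuclideanSpace ℂ m)) (v : ι → EuclideanSpace ℂ m) (hv : ∀ i, v i ∈ V) :
    ∃ u : ι → EuclideanSpace ℂ m, (∀ i, u i ∈ V) ∧ (∀ i j, i ≠ j → ⟪u i, u j⟫_ℂ = 0) ∧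
      ∀ k, ∑ i, u i k * star (u i k) = ∑ i, v i k * star (v i k) := by
  classical
  have hG := isHermitian_gram ℂ v
  let b := hG.eigenvectorBasis
  refine ⟨fun a => ∑ i, b a i • v i, fun a => V.sum_mem fun i _ => V.smul_mem _ (hv i), ?_, ?_⟩
  · intro a c hac
    rw [← star_dotProduct_gram_mulVec, hG.mulVec_eigenvectorBasis, dotProduct_smul,
      dotProduct_comm, ← EuclideanSpace.inner_eq_star_dotProduct, b.inner_eq_zero hac, smul_zero]
  · intro k
    let x : EuclideanSpace ℂ ι := WithLp.toLp 2 fun i => star (v i k)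
    have hx : ∀ a, (∑ i, b a i • v i) k = ⟪x, b a⟫_ℂ := fun a => by
      simp [x, PiLp.inner_apply]
    simp_rw [hx, ← starRingEnd_apply, inner_conj_symm]
    rw [b.sum_inner_mul_inner]
    rw [PiLp.inner_apply]
    simp [x, Complex.mul_conj']

/-- A nonempty finite family of nonzero vectors of a subspace of `ℂ^n` has the same Hadamard sum as
some nonempty finite family of pairwise orthogonal nonzero vectors of that subspace. -/
theorem exists_fin_pairwise_orthogonal_ne_zero_hadamard_sum_eq {n p : ℕ} (hp : 0 < p)
    (V : Submodule ℂ (EuclideanSpace ℂ (Fin n)))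
    (v : Fin p → EuclideanSpace ℂ (Fin n)) (hv : ∀ i, v i ∈ V) (hv0 : ∀ i, v i ≠ 0) :
    ∃ t : ℕ, 0 < t ∧ ∃ u : Fin t → EuclideanSpace ℂ (Fin n),
      (∀ i, u i ∈ V) ∧ (∀ i, u i ≠ 0) ∧ (∀ i j, i ≠ j → ⟪u i, u j⟫_ℂ = 0) ∧
      ∀ k, ∑ i, u i k * star (u i k) = ∑ i, v i k * star (v i k) := by
  classical
  obtain ⟨u, huV, horth, hsum⟩ := exists_pairwise_orthogonal_hadamard_sum_eq V v hv
  let e := Fintype.equivFin {i // u i ≠ 0}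
  refine ⟨Fintype.card {i // u i ≠ 0}, ?_, fun i => u (e.symm i), fun i => huV _,
    fun i => (e.symm i).2, fun i j hij => horth _ _ fun h =>
      hij (e.symm.injective (Subtype.ext h)), fun k => ?_⟩
  · rw [Fintype.card_pos_iff]
    by_contra hempty
    have hu : ∀ i, u i = 0 := fun i => by_contra fun hi => hempty ⟨⟨i, hi⟩⟩
    refine hv0 ⟨0, hp⟩ (PiLp.ext fun k => ?_)
    have hk : ∑ i, ‖v i k‖ ^ 2 = 0 := by
      have := hsum k
      simp only [hu, PiLp.zero_apply, zero_mul, Finset.sum_const_zero, ← starRingEnd_apply,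
        Complex.mul_conj'] at this
      exact_mod_cast this.symm
    rw [Finset.sum_eq_zero_iff_of_nonneg fun i _ => by positivity] at hk
    simpa using hk ⟨0, hp⟩ (Finset.mem_univ _)
  · rw [← hsum k, e.symm.sum_comp fun i : {i // u i ≠ 0} => u i k * star (u i k),
      ← Finset.sum_subtype (Finset.univ.filter fun i => u i ≠ 0) (by simp)
        fun i => u i k * star (u i k)]
    refine Finset.sum_filter_of_ne fun i _ hi hu => hi ?_
    simp [hu]

/-- If orthogonal subspaces `V, W` of `ℂ^n` admit nonzero vectors with equal
Hadamard sums, then they admit pairwise orthogonal nonzero vectors with equal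
Hadamard sums. -/
theorem support_with_orthogonal_vectors (n p q : ℕ) (hp : 0 < p) (hq : 0 < q)
    (V W : Submodule ℂ (EuclideanSpace ℂ (Fin n)))
    (hVW : ∀ v ∈ V, ∀ w ∈ W, ⟪v, w⟫_ℂ = 0)
    (v : Fin p → EuclideanSpace ℂ (Fin n)) (hvV : ∀ i, v i ∈ V) (hv0 : ∀ i, v i ≠ 0)
    (w : Fin q → EuclideanSpace ℂ (Fin n)) (hwW : ∀ j, w j ∈ W) (hw0 : ∀ j, w j ≠ 0)
    (heq : ∀ k : Fin n, ∑ i, v i k * star (v i k) = ∑ j, w j k * star (w j k)) :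
    ∃ (t h : ℕ), 0 < t ∧ 0 < h ∧
      ∃ (vt : Fin t → EuclideanSpace ℂ (Fin n)) (wt : Fin h → EuclideanSpace ℂ (Fin n)),
        (∀ i, vt i ∈ V) ∧ (∀ i, vt i ≠ 0) ∧
        (∀ i i', i ≠ i' → ⟪vt i, vt i'⟫_ℂ = 0) ∧
        (∀ j, wt j ∈ W) ∧ (∀ j, wt j ≠ 0) ∧
        (∀ j j', j ≠ j' → ⟪wt j, wt j'⟫_ℂ = 0) ∧
        (∀ k : Fin n, ∑ i, vt i k * star (vt i k) = ∑ j, wt j k * star (wt j k)) := by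
  obtain ⟨t, ht, vt, hvt, hvt0, hvto, hvts⟩ :=
    exists_fin_pairwise_orthogonal_ne_zero_hadamard_sum_eq hp V v hvV hv0
  obtain ⟨h, hh, wt, hwt, hwt0, hwto, hwts⟩ :=
    exists_fin_pairwise_orthogonal_ne_zero_hadamard_sum_eq hq W w hwW hw0
  exact ⟨t, h, ht, hh, vt, wt, hvt, hvt0, hvto, hwt, hwt0, hwto, fun k => by
    rw [hvts, hwts, heq]⟩
end

section
/- The set S_{(r,s)} of supports is closed in F_{(r,s)}: if (V_k, W_k) is a sequence of supports in ℂ^n with dim V_k = r, dim W_k = s, V_k ⊥ W_k, and the orthogonal projections P_{V_k} → P_V and P_{W_k} → P_W converge, then (V,W) is a support. -/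
open Matrix

open scoped ComplexOrder MatrixOrder Matrix.Norms.L2Operator in
/-- Every matrix `A` whose columns are fixed by `P` has a square companion with the same Gram
matrix `A * Aᴴ`, whose columns are again fixed by `P`. -/
lemma exists_square_same_gram {n p : ℕ} (P : Matrix (Fin n) (Fin n) ℂ)
    (A : Matrix (Fin n) (Fin p) ℂ) (hA : P * A = A) :
    ∃ B : Matrix (Fin n) (Fin n) ℂ, P * B = B ∧ B * Bᴴ = A * Aᴴ := by
  obtain ⟨C, hC⟩ := CStarAlgebra.nonneg_iff_eq_star_mul_self.mp
    (Matrix.posSemidef_self_mul_conjTranspose A).nonneg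
  rw [star_eq_conjTranspose] at hC
  refine ⟨Cᴴ, ?_, by rw [conjTranspose_conjTranspose, ← hC]⟩
  have h : ((1 - P) * Cᴴ) * ((1 - P) * Cᴴ)ᴴ = 0 := by
    rw [conjTranspose_mul, conjTranspose_conjTranspose, Matrix.mul_assoc, ← Matrix.mul_assoc Cᴴ,
      ← hC, ← Matrix.mul_assoc, ← Matrix.mul_assoc, Matrix.sub_mul, hA, Matrix.one_mul, sub_self,
      Matrix.zero_mul, Matrix.zero_mul]
  rw [Matrix.self_mul_conjTranspose_eq_zero, Matrix.sub_mul, Matrix.one_mul, sub_eq_zero] at h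
  exact h.symm

/-- A family of vectors fixed by `P` can be replaced by the columns of a square matrix, without
changing the sum of the entrywise squared moduli. -/
lemma exists_square_of_family {n p : ℕ} (P : Matrix (Fin n) (Fin n) ℂ)
    (v : Fin p → Fin n → ℂ) (hv : ∀ i, P.mulVec (v i) = v i) :
    ∃ B : Matrix (Fin n) (Fin n) ℂ, P * B = B ∧
      ∀ m, ∑ j, B m j * star (B m j) = ∑ i, v i m * star (v i m) := by
  obtain ⟨B, hB, hg⟩ := exists_square_same_gram P (Matrix.of fun m i => v i m) (by
    ext m i
    exact congrFun (hv i) m)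
  refine ⟨B, hB, fun m => ?_⟩
  have := congrFun (congrFun hg m) m
  simpa [Matrix.mul_apply] using this

/-- The nonzero columns of a nonzero matrix, as a finite family of vectors. -/
lemma exists_family_of_square {n : ℕ} (P B : Matrix (Fin n) (Fin n) ℂ) (hB : P * B = B)
    (h0 : B ≠ 0) :
    ∃ p : ℕ, 0 < p ∧ ∃ v : Fin p → Fin n → ℂ,
      (∀ i, P.mulVec (v i) = v i) ∧ (∀ i, v i ≠ 0) ∧
      ∀ m, ∑ i, v i m * star (v i m) = ∑ j, B m j * star (B m j) := by
  classical
  let e := Fintype.equivFin {j : Fin n // Bᵀ j ≠ 0}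
  refine ⟨_, Fintype.card_pos_iff.mpr ?_, fun i => Bᵀ (e.symm i).1, fun i => ?_,
    fun i => (e.symm i).2, fun m => ?_⟩
  · by_contra h
    rw [nonempty_subtype] at h
    push Not at h
    exact h0 (by ext m j; exact congrFun (h j) m)
  · ext m
    exact congrFun (congrFun hB m) _
  · change ∑ i, B m (e.symm i).1 * star (B m (e.symm i).1) = _
    rw [Equiv.sum_comp e.symm (fun j => B m j.1 * star (B m j.1)),
      ← Finset.sum_subtype (Finset.univ.filter fun j => Bᵀ j ≠ 0) (by simp)
        (fun j => B m j * star (B m j))]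
    refine Finset.sum_filter_of_ne fun j _ hj h => hj ?_
    have : B m j = 0 := congrFun h m
    simp [this]

/-- The entries of a matrix of Frobenius norm one lie in the unit ball. -/
lemma mem_closedBall_of_sum_mul_star_eq_one {n : ℕ} (B : Fin n → Fin n → ℂ)
    (h : ∑ m, ∑ j, B m j * star (B m j) = 1) : B ∈ Metric.closedBall 0 1 := by
  have hr : ∑ m, ∑ j, ‖B m j‖ ^ 2 = 1 := by
    have h' : ((∑ m, ∑ j, ‖B m j‖ ^ 2 : ℝ) : ℂ) = 1 := by
      rw [← h]
      push_cast
      simp [Complex.mul_conj']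
    exact_mod_cast h'
  rw [mem_closedBall_zero_iff]
  refine (pi_norm_le_iff_of_nonneg zero_le_one).mpr fun m =>
    (pi_norm_le_iff_of_nonneg zero_le_one).mpr fun j => ?_
  have h1 : ‖B m j‖ ^ 2 ≤ ∑ j, ‖B m j‖ ^ 2 :=
    Finset.single_le_sum (f := fun j => ‖B m j‖ ^ 2) (fun _ _ => by positivity) (Finset.mem_univ j)
  have h2 : ∑ j, ‖B m j‖ ^ 2 ≤ ∑ m, ∑ j, ‖B m j‖ ^ 2 :=
    Finset.single_le_sum (f := fun m => ∑ j, ‖B m j‖ ^ 2) (fun _ _ => by positivity)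
      (Finset.mem_univ m)
  exact (sq_le_one_iff₀ (norm_nonneg _)).mp (by linarith)

/-- A pair of nonzero families with equal sums of entrywise squared moduli yields a pair of square
matrices with the same property, normalized to Frobenius norm one. -/
lemma exists_normalized_squares {n p q : ℕ} (P Q : Matrix (Fin n) (Fin n) ℂ) (hp : 0 < p)
    (v : Fin p → Fin n → ℂ) (w : Fin q → Fin n → ℂ)
    (hv : ∀ i, P.mulVec (v i) = v i) (hv0 : ∀ i, v i ≠ 0) (hw : ∀ j, Q.mulVec (w j) = w j)
    (hvw : ∀ m : Fin n, ∑ i, v i m * star (v i m) = ∑ j, w j m * star (w j m)) :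
    ∃ A B : Matrix (Fin n) (Fin n) ℂ, P * A = A ∧ Q * B = B ∧
      (∀ m, ∑ j, A m j * star (A m j) = ∑ j, B m j * star (B m j)) ∧
      ∑ m, ∑ j, A m j * star (A m j) = 1 := by
  obtain ⟨A, hA, hAs⟩ := exists_square_of_family P v hv
  obtain ⟨B, hB, hBs⟩ := exists_square_of_family Q w hw
  obtain ⟨t, ht, hts⟩ : ∃ t : ℝ, 0 < t ∧ ((t : ℝ) : ℂ) = ∑ m, ∑ j, A m j * star (A m j) := by
    refine ⟨∑ m, ∑ i, ‖v i m‖ ^ 2, ?_, ?_⟩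
    · obtain ⟨m, hm⟩ := Function.ne_iff.mp (hv0 ⟨0, hp⟩)
      refine Finset.sum_pos' (fun _ _ => by positivity) ⟨m, Finset.mem_univ _, ?_⟩
      refine Finset.sum_pos' (fun _ _ => by positivity) ⟨⟨0, hp⟩, Finset.mem_univ _, ?_⟩
      have : 0 < ‖v ⟨0, hp⟩ m‖ := norm_pos_iff.mpr hm
      positivity
    · simp_rw [hAs]
      push_cast
      simp [Complex.mul_conj']
  obtain ⟨c, hc⟩ : ∃ c : ℂ, c * star c * (t : ℂ) = 1 := by
    refine ⟨((√t)⁻¹ : ℝ), ?_⟩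
    have h : (√t)⁻¹ * (√t)⁻¹ * t = 1 := by
      rw [← mul_inv, Real.mul_self_sqrt ht.le, inv_mul_cancel₀ ht.ne']
    rw [Complex.star_def, Complex.conj_ofReal]
    exact_mod_cast h
  have scale (M : Matrix (Fin n) (Fin n) ℂ) (m : Fin n) :
      ∑ j, (c • M) m j * star ((c • M) m j) = c * star c * ∑ j, M m j * star (M m j) := by
    rw [Finset.mul_sum]
    refine Finset.sum_congr rfl fun j _ => ?_
    rw [Matrix.smul_apply, smul_eq_mul, star_mul']
    ring
  refine ⟨c • A, c • B, by rw [Matrix.mul_smul, hA], by rw [Matrix.mul_smul, hB], fun m => ?_, ?_⟩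
  · rw [scale, scale, hAs, hBs, hvw]
  · simp_rw [scale]
    rw [← Finset.mul_sum, ← hts, hc]

/-- The set of supports is closed: if a sequence of supports `(V_k, W_k)`,
given by orthogonal projections `P k`, `Q k` of ranks `r`, `s`, converges
(in the sense that the projections converge), then the limit pair is a support. -/
theorem supports_closed (n r s : ℕ)
    (P Q : ℕ → Matrix (Fin n) (Fin n) ℂ)
    (Plim Qlim : Matrix (Fin n) (Fin n) ℂ)
    (hPproj : ∀ k, P k * P k = P k ∧ (P k)ᴴ = P k)
    (hQproj : ∀ k, Q k * Q k = Q k ∧ (Q k)ᴴ = Q k)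
    (hPrank : ∀ k, (P k).rank = r) (hQrank : ∀ k, (Q k).rank = s)
    (horth : ∀ k, P k * Q k = 0)
    (hsupp : ∀ k, ∃ p q : ℕ, 0 < p ∧ 0 < q ∧
      ∃ (v : Fin p → Fin n → ℂ) (w : Fin q → Fin n → ℂ),
        (∀ i, (P k).mulVec (v i) = v i) ∧ (∀ i, v i ≠ 0) ∧
        (∀ j, (Q k).mulVec (w j) = w j) ∧ (∀ j, w j ≠ 0) ∧
        ∀ m : Fin n, ∑ i, v i m * star (v i m) = ∑ j, w j m * star (w j m))
    (hPlim : Filter.Tendsto P Filter.atTop (nhds Plim))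
    (hQlim : Filter.Tendsto Q Filter.atTop (nhds Qlim)) :
    ∃ p q : ℕ, 0 < p ∧ 0 < q ∧
      ∃ (v : Fin p → Fin n → ℂ) (w : Fin q → Fin n → ℂ),
        (∀ i, Plim.mulVec (v i) = v i) ∧ (∀ i, v i ≠ 0) ∧
        (∀ j, Qlim.mulVec (w j) = w j) ∧ (∀ j, w j ≠ 0) ∧
        ∀ m : Fin n, ∑ i, v i m * star (v i m) = ∑ j, w j m * star (w j m) := by
  have key (k : ℕ) : ∃ A B : Matrix (Fin n) (Fin n) ℂ, P k * A = A ∧ Q k * B = B ∧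
      (∀ m, ∑ j, A m j * star (A m j) = ∑ j, B m j * star (B m j)) ∧
      ∑ m, ∑ j, A m j * star (A m j) = 1 := by
    obtain ⟨p, q, hp, -, v, w, hv, hv0, hw, -, hvw⟩ := hsupp k
    exact exists_normalized_squares (P k) (Q k) hp v w hv hv0 hw hvw
  choose A B hA hB hAB hA1 using key
  have hB1 (k : ℕ) : ∑ m, ∑ j, B k m j * star (B k m j) = 1 := by
    rw [← hA1 k]
    exact Finset.sum_congr rfl fun m _ => (hAB k m).symm
  have hcpt : IsCompact (Metric.closedBall (0 : Fin n → Fin n → ℂ) 1 ×ˢ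
      Metric.closedBall (0 : Fin n → Fin n → ℂ) 1) :=
    (isCompact_closedBall _ _).prod (isCompact_closedBall _ _)
  obtain ⟨⟨A', B'⟩, -, φ, hφ, hlim⟩ := hcpt.tendsto_subseq
    (x := fun k => ((fun m j => A k m j), (fun m j => B k m j))) fun k =>
    ⟨mem_closedBall_of_sum_mul_star_eq_one _ (hA1 k),
      mem_closedBall_of_sum_mul_star_eq_one _ (hB1 k)⟩
  have hlA : Filter.Tendsto (fun k => A (φ k)) Filter.atTop (nhds (Matrix.of A')) :=
    (continuous_fst.tendsto _).comp hlim
  have hlB : Filter.Tendsto (fun k => B (φ k)) Filter.atTop (nhds (Matrix.of B')) :=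
    (continuous_snd.tendsto _).comp hlim
  generalize Matrix.of A' = A₀ at hlA
  generalize Matrix.of B' = B₀ at hlB
  have mul_lim {R : ℕ → Matrix (Fin n) (Fin n) ℂ} {R₀ M₀ : Matrix (Fin n) (Fin n) ℂ}
      {M : ℕ → Matrix (Fin n) (Fin n) ℂ} (hR : Filter.Tendsto R Filter.atTop (nhds R₀))
      (hM : Filter.Tendsto (fun k => M (φ k)) Filter.atTop (nhds M₀))
      (h : ∀ k, R k * M k = M k) : R₀ * M₀ = M₀ := by
    refine tendsto_nhds_unique ?_ hM
    simpa only [Function.comp_def, h] using (hR.comp hφ.tendsto_atTop).mul hM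
  have hcont (m : Fin n) : Continuous fun M : Matrix (Fin n) (Fin n) ℂ =>
      ∑ j, M m j * star (M m j) := by fun_prop
  have hsum (m : Fin n) : ∑ j, A₀ m j * star (A₀ m j) = ∑ j, B₀ m j * star (B₀ m j) := by
    refine tendsto_nhds_unique (((hcont m).tendsto _).comp hlA) ?_
    simpa only [Function.comp_def, hAB] using ((hcont m).tendsto _).comp hlB
  have hA₁ : ∑ m, ∑ j, A₀ m j * star (A₀ m j) = 1 := by
    refine tendsto_nhds_unique
      (((continuous_finsetSum _ fun m _ => hcont m).tendsto _).comp hlA) ?_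
    simp only [Function.comp_def, hA1, tendsto_const_nhds]
  have hA₀ : A₀ ≠ 0 := by
    rintro rfl
    simp at hA₁
  have hB₀ : B₀ ≠ 0 := by
    rintro rfl
    simp_rw [hsum] at hA₁
    simp at hA₁
  obtain ⟨p, hp, v, hv, hv0, hvs⟩ :=
    exists_family_of_square Plim A₀ (mul_lim hPlim hlA hA) hA₀
  obtain ⟨q, hq, w, hw, hw0, hws⟩ :=
    exists_family_of_square Qlim B₀ (mul_lim hQlim hlB hB) hB₀
  exact ⟨p, q, hp, hq, v, w, hv, hv0, hw, hw0, fun m => by rw [hvs, hws, hsum]⟩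
end
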